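/- Let A and B be disjoint finite sets of ground equality literals over a first-order signature of function symbols, let Σ_A and Σ_B be the sets of function symbols occurring in A and in B respectively, and call a ground term A-colorable (resp. B-colorable) if all its function symbols belong to Σ_A (resp. Σ_B), and colorable if it is A-colorable or B-colorable. Let E = (A ∪ B)_= be the set of equations in A ∪ B, and let ⊢ be the smallest relation on colorable ground terms that is reflexive, symmetric and transitive, contains every pair (s, t) with (s = t) ∈ E, and is closed under colorable congruence: whenever f(u₁,…,u_k) and f(v₁,…,v_k) are both colorable and uᵢ ⊢ vᵢ for all i ≤ k, then f(u₁,…,u_k) ⊢ f(v₁,…,v_k). If s and t are colorable ground terms and E ⊨ s = t, then s ⊢ t. -/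

import Mathlib

open FirstOrder Language

universe u v

/-- Value of a ground term in a structure. -/
def gval {L : FirstOrder.Language.{u, v}} (M : Type) (str : L.Structure M) (t : L.Term Empty) : M :=
  letI := str
  t.realize Empty.elim

/-- A function symbol (paired with its arity) occurs in a term. -/
inductive TFunc {L : FirstOrder.Language.{u, v}} {α : Type*} : (Σ n, L.Functions n) → L.Term α → Prop
  | head {k : ℕ} (f : L.Functions k) (ts : Fin k → L.Term α) : TFunc ⟨k, f⟩ (Term.func f ts)
  | arg {k : ℕ} (f : L.Functions k) (ts : Fin k → L.Term α) (i : Fin k) {g} :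
      TFunc g (ts i) → TFunc g (Term.func f ts)

/-- A ground equality literal: `(true, s, t)` is the equation `s = t`,
`(false, s, t)` the disequation `s ≠ t`. -/
abbrev GLit (L : FirstOrder.Language.{u, v}) := Bool × L.Term Empty × L.Term Empty

/-- The function symbols occurring in (the terms of) a set of ground literals. -/
def SymbolsOf {L : FirstOrder.Language.{u, v}} (A : Set (GLit L)) : Set (Σ n, L.Functions n) :=
  {g | ∃ l ∈ A, TFunc g l.2.1 ∨ TFunc g l.2.2}

/-- All function symbols of the term `t` belong to `S`. -/
def TermOver {L : FirstOrder.Language.{u, v}} (S : Set (Σ n, L.Functions n)) (t : L.Term Empty) : Prop :=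
  ∀ g, TFunc g t → g ∈ S

/-- `E ⊨ s = t` for a set `E` of ground equations (pairs of ground terms). -/
def EntailsEq {L : FirstOrder.Language.{u, v}} (E : Set (L.Term Empty × L.Term Empty))
    (s t : L.Term Empty) : Prop :=
  ∀ (M : Type) (str : L.Structure M), Nonempty M →
    (∀ p ∈ E, gval M str p.1 = gval M str p.2) →
    gval M str s = gval M str t

/-- The smallest relation on colorable ground terms (`C` is the colorability
predicate) that is reflexive, symmetric and transitive, contains every pair of
`E`, and is closed under colorable congruence. -/
inductive ColorDeriv {L : FirstOrder.Language.{u, v}} (E : Set (L.Term Empty × L.Term Empty))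
    (C : L.Term Empty → Prop) : L.Term Empty → L.Term Empty → Prop
  | refl {t} (h : C t) : ColorDeriv E C t t
  | base {s t} (h : (s, t) ∈ E) : ColorDeriv E C s t
  | symm {s t} (h : ColorDeriv E C s t) : ColorDeriv E C t s
  | trans {s t u} (h₁ : ColorDeriv E C s t) (h₂ : ColorDeriv E C t u) : ColorDeriv E C s u
  | congr {k : ℕ} {f : L.Functions k} {u v : Fin k → L.Term Empty}
      (hu : C (Term.func f u)) (hv : C (Term.func f v))
      (h : ∀ i, ColorDeriv E C (u i) (v i)) :
      ColorDeriv E C (Term.func f u) (Term.func f v)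

theorem countable_setOf_tFunc {L : FirstOrder.Language.{u, v}} {α : Type*} (t : L.Term α) :
    {g | TFunc g t}.Countable := by
  induction t with
  | var a =>
    convert Set.countable_empty
    ext g
    simp only [Set.mem_ofPred_eq, Set.mem_empty_iff_false, iff_false]
    rintro ⟨⟩
  | @func k f ts ih =>
    refine ((Set.countable_singleton ⟨k, f⟩).union (Set.countable_iUnion ih)).mono ?_
    rintro g (_ | ⟨_, _, i, h⟩)
    · exact Or.inl rfl
    · exact Or.inr (Set.mem_iUnion.2 ⟨i, h⟩)

theorem countable_symbolsOf {L : FirstOrder.Language.{u, v}} {A : Set (GLit L)}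
    (hA : A.Countable) : (SymbolsOf A).Countable := by
  refine (hA.biUnion fun l _ =>
    (countable_setOf_tFunc l.2.1).union (countable_setOf_tFunc l.2.2)).mono ?_
  rintro g ⟨l, hl, h⟩
  exact Set.mem_biUnion hl h

theorem TermOver.arg {L : FirstOrder.Language.{u, v}} {S : Set (Σ n, L.Functions n)} {k : ℕ}
    {f : L.Functions k} {ts : Fin k → L.Term Empty} (h : TermOver S (Term.func f ts)) (i : Fin k) :
    TermOver S (ts i) :=
  fun _ hg => h _ (.arg f ts i hg)

/-- The sublanguage of `L` whose function symbols are those in `S`, without relation symbols. -/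
def restrictFunctions {L : FirstOrder.Language.{u, v}} (S : Set (Σ n, L.Functions n)) :
    FirstOrder.Language.{u, v} where
  Functions n := {f : L.Functions n // (⟨n, f⟩ : Σ n, L.Functions n) ∈ S}
  Relations _ := PEmpty

/-- The inclusion of the restricted language into `L`. -/
def restrictFunctionsHom {L : FirstOrder.Language.{u, v}} (S : Set (Σ n, L.Functions n)) :
    restrictFunctions S →ᴸ L where
  onFunction _ f := f.1
  onRelation _ r := r.elim

theorem TermOver.exists_onTerm {L : FirstOrder.Language.{u, v}} {S : Set (Σ n, L.Functions n)}
    {t : L.Term Empty} (h : TermOver S t) : ∃ t', (restrictFunctionsHom S).onTerm t' = t := by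
  induction t with
  | var a => exact a.elim
  | func f ts ih =>
    choose ts' hts' using fun i => ih i (h.arg i)
    exact ⟨Term.func (⟨f, h _ (.head f ts)⟩ : (restrictFunctions S).Functions _) ts',
      congrArg (Term.func f) (funext hts')⟩

theorem countable_setOf_termOver {L : FirstOrder.Language.{u, v}} {S : Set (Σ n, L.Functions n)}
    (hS : S.Countable) : {t | TermOver S t}.Countable := by
  have := hS.to_subtype
  have : Countable (Σ n, (restrictFunctions S).Functions n) := by
    refine Function.Injective.countable (f := fun g => (⟨⟨g.1, g.2.1⟩, g.2.2⟩ : S)) ?_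
    rintro ⟨n, f, hf⟩ ⟨m, g, hg⟩ h
    cases congrArg Subtype.val h
    rfl
  exact (Set.countable_range (restrictFunctionsHom S).onTerm).mono fun t ht => ht.exists_onTerm

/-- Derivability as a setoid on the colorable terms. -/
def colorDerivSetoid {L : FirstOrder.Language.{u, v}} (E : Set (L.Term Empty × L.Term Empty))
    (C : L.Term Empty → Prop) : Setoid {t // C t} where
  r s t := ColorDeriv E C s t
  iseqv := ⟨fun t => .refl t.2, .symm, .trans⟩

/-- Colorable derivability is complete for any countable class `C` of ground terms that is closed
under subterms and contains the terms of `E`: the derivability classes together with one extra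
element carry a structure in which every term of `C` denotes its own class. -/
theorem ColorDeriv.of_entailsEq {L : FirstOrder.Language.{u, v}}
    {E : Set (L.Term Empty × L.Term Empty)} {C : L.Term Empty → Prop}
    (hcount : {t | C t}.Countable)
    (hsub : ∀ {k : ℕ} (f : L.Functions k) (ts : Fin k → L.Term Empty),
      C (Term.func f ts) → ∀ i, C (ts i))
    (hEC : ∀ p ∈ E, C p.1 ∧ C p.2)
    {s t : L.Term Empty} (hs : C s) (ht : C t) (hent : EntailsEq E s t) :
    ColorDeriv E C s t := by
  classical
  have : Countable {t // C t} := hcount.to_subtype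
  let Q := Quotient (colorDerivSetoid E C)
  let e : Option Q ≃ Shrink.{0} (Option Q) := equivShrink _
  let cls : {t // C t} → Shrink.{0} (Option Q) := fun t => e (some (Quotient.mk _ t))
  have cls_eq (a b : {t // C t}) : cls a = cls b ↔ ColorDeriv E C a b := by
    simp only [cls, e.apply_eq_iff_eq, Option.some.injEq]
    exact Quotient.eq (r := colorDerivSetoid E C)
  let Represents {k : ℕ} (f : L.Functions k) (x : Fin k → Shrink.{0} (Option Q))
      (u : Fin k → {t // C t}) : Prop :=
    C (Term.func f fun i => u i) ∧ ∀ i, cls (u i) = x i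
  let str : L.Structure (Shrink.{0} (Option Q)) :=
    { funMap := fun f x =>
        if h : ∃ u, Represents f x u then cls ⟨_, h.choose_spec.1⟩ else e none
      RelMap := fun _ _ => False }
  have gval_eq (t : L.Term Empty) (ht : C t) : gval _ str t = cls ⟨t, ht⟩ := by
    induction t with
    | var a => exact a.elim
    | func f ts ih =>
      have hrep : ∃ u, Represents f (fun i => gval _ str (ts i)) u :=
        ⟨fun i => ⟨ts i, hsub f ts ht i⟩, ht, fun i => (ih i (hsub f ts ht i)).symm⟩
      refine (dif_pos hrep : gval _ str (Term.func f ts) = _).trans ((cls_eq _ _).2 ?_)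
      refine .congr hrep.choose_spec.1 ht fun i => ?_
      exact (cls_eq _ ⟨ts i, hsub f ts ht i⟩).1 ((hrep.choose_spec.2 i).trans (ih i _))
  have key := hent _ str ⟨e none⟩ fun p hp => by
    rw [gval_eq _ (hEC p hp).1, gval_eq _ (hEC p hp).2, cls_eq]
    exact .base hp
  rw [gval_eq s hs, gval_eq t ht] at key
  exact (cls_eq _ _).1 key

/-- Let `A`, `B` be disjoint finite sets of ground equality
literals, let a term be colorable if all its function symbols occur in `A` or all
its function symbols occur in `B`, and let `E` be the set of equations of `A ∪ B`.
If `s` and `t` are colorable and `E ⊨ s = t`, then `s ⊢ t` in the colorable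
congruence-derivation relation generated by `E`. -/
theorem colorable_derivation_complete
    {L : FirstOrder.Language.{u, v}} (A B : Set (GLit L))
    (hdisj : Disjoint A B) (hAfin : A.Finite) (hBfin : B.Finite)
    (E : Set (L.Term Empty × L.Term Empty))
    (hE : E = {p | (true, p.1, p.2) ∈ A ∪ B})
    (C : L.Term Empty → Prop)
    (hC : ∀ t, C t ↔ (TermOver (SymbolsOf A) t ∨ TermOver (SymbolsOf B) t))
    (s t : L.Term Empty) (hs : C s) (ht : C t)
    (hent : EntailsEq E s t) :
    ColorDeriv E C s t := by
  refine ColorDeriv.of_entailsEq ?_ ?_ ?_ hs ht hent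
  · simp only [hC, Set.ofPred_or]
    exact (countable_setOf_termOver (countable_symbolsOf hAfin.countable)).union
      (countable_setOf_termOver (countable_symbolsOf hBfin.countable))
  · intro k f ts h i
    rw [hC] at h ⊢
    exact h.imp (·.arg i) (·.arg i)
  · rintro p hp
    rw [hE] at hp
    rw [hC, hC]
    rcases hp with hp | hp
    · exact ⟨.inl fun g hg => ⟨_, hp, .inl hg⟩, .inl fun g hg => ⟨_, hp, .inr hg⟩⟩
    · exact ⟨.inr fun g hg => ⟨_, hp, .inl hg⟩, .inr fun g hg => ⟨_, hp, .inr hg⟩⟩
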